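/- Let f : (0,2) → [0,∞) be injective, suppose f(γ) → 0 as γ → 0⁺, and suppose f has no upward jumps on (0,2), i.e., liminf_{y→x⁻} f(y) ≥ f(x) and limsup_{y→x⁺} f(y) ≤ f(x) for each x ∈ (0,2). Then f is strictly increasing on (0,2). -/

import Mathlib

open Filter Topology in
/-- Intermediate value property: a function that is lower semicontinuous from the left and upper
semicontinuous from the right at level `v` attains the value `v` if `f a < v < f b`. -/
theorem exists_mem_Icc_eq_of_no_upward_jumps {f : ℝ → ℝ} {a b v : ℝ} (hab : a ≤ b)
    (hleft : ∀ x ∈ Set.Ioc a b, v < f x → ∀ᶠ y in 𝓝[<] x, v < f y)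
    (hright : ∀ x ∈ Set.Ico a b, f x < v → ∀ᶠ y in 𝓝[>] x, f y < v)
    (ha : f a < v) (hb : v < f b) : ∃ c ∈ Set.Icc a b, f c = v := by
  set S := {x | x ∈ Set.Icc a b ∧ f x ≤ v}
  have haS : a ∈ S := ⟨⟨le_rfl, hab⟩, ha.le⟩
  have hbdd : BddAbove S := ⟨b, fun x hx => hx.1.2⟩
  have hlub : IsLUB S (sSup S) := isLUB_csSup ⟨a, haS⟩ hbdd
  set c := sSup S
  have hac : a ≤ c := hlub.1 haS
  have hcb : c ≤ b := hlub.2 fun x hx => hx.1.2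
  refine ⟨c, ⟨hac, hcb⟩, ?_⟩
  rcases lt_trichotomy (f c) v with h | h | h
  · have hcb' : c < b := hcb.lt_of_ne (by rintro h'; rw [h'] at h; exact h.not_gt hb)
    obtain ⟨y, hy, hyc, hyb⟩ :=
      ((hright c ⟨hac, hcb'⟩ h).and (Ioo_mem_nhdsGT hcb')).exists
    exact absurd (hlub.1 ⟨⟨hac.trans hyc.le, hyb.le⟩, hy.le⟩) hyc.not_ge
  · exact h
  · have hac' : a < c := hac.lt_of_ne (by rintro h'; rw [← h'] at h; exact h.not_gt ha)
    obtain ⟨l, hlc, hl⟩ :=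
      (mem_nhdsLT_iff_exists_Ioo_subset' hac').1 (hleft c ⟨hac', hcb⟩ h)
    obtain ⟨y, hyS, hly, hyc⟩ := hlub.exists_between hlc
    rcases hyc.eq_or_lt with rfl | hyc
    · exact absurd hyS.2 h.not_ge
    · exact absurd hyS.2 (not_le.2 (hl ⟨hly, hyc⟩))

/-- The open-interval variant of Lemma 2.4: an injective function `f : (0,2) → [0,∞)`
which tends to `0` as `γ → 0⁺` and has no upward jumps on `(0,2)` is strictly increasing
on `(0,2)`. -/
theorem strictMonoOn_of_no_upward_jumps_open (f : ℝ → ℝ)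
    (hnonneg : ∀ x ∈ Set.Ioo (0:ℝ) 2, 0 ≤ f x)
    (hinj : Set.InjOn f (Set.Ioo 0 2))
    (hlim : Filter.Tendsto f (nhdsWithin 0 (Set.Ioo (0:ℝ) 2)) (nhds 0))
    (hjump : ∀ x ∈ Set.Ioo (0:ℝ) 2,
      ((f x : ℝ) : EReal) ≤
        Filter.liminf (fun y : ℝ => ((f y : ℝ) : EReal))
          (nhdsWithin x (Set.Ioo 0 2 ∩ Set.Iio x)) ∧
      Filter.limsup (fun y : ℝ => ((f y : ℝ) : EReal))
          (nhdsWithin x (Set.Ioo 0 2 ∩ Set.Ioi x)) ≤ ((f x : ℝ) : EReal)) :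
    StrictMonoOn f (Set.Ioo 0 2) := by
  have hnhds {x : ℝ} (hx : x ∈ Set.Ioo (0 : ℝ) 2) (t : Set ℝ) :
      nhdsWithin x (Set.Ioo 0 2 ∩ t) = nhdsWithin x t := by
    rw [Set.inter_comm]
    exact nhdsWithin_inter_of_mem' (nhdsWithin_le_nhds (Ioo_mem_nhds hx.1 hx.2))
  have hleft {x v : ℝ} (hx : x ∈ Set.Ioo (0 : ℝ) 2) (hv : v < f x) :
      ∀ᶠ y in nhdsWithin x (Set.Iio x), v < f y := by
    rw [← hnhds hx]
    exact (Filter.eventually_lt_of_lt_liminf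
      ((EReal.coe_lt_coe_iff.2 hv).trans_le (hjump x hx).1)).mono
      fun _ h => EReal.coe_lt_coe_iff.1 h
  have hright {x v : ℝ} (hx : x ∈ Set.Ioo (0 : ℝ) 2) (hv : f x < v) :
      ∀ᶠ y in nhdsWithin x (Set.Ioi x), f y < v := by
    rw [← hnhds hx]
    exact (Filter.eventually_lt_of_limsup_lt
      ((hjump x hx).2.trans_lt (EReal.coe_lt_coe_iff.2 hv))).mono
      fun _ h => EReal.coe_lt_coe_iff.1 h
  have hpos {a b : ℝ} (ha : a ∈ Set.Ioo (0 : ℝ) 2) (hb : b ∈ Set.Ioo (0 : ℝ) 2) (hab : a < b)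
      (hfb : 0 < f b) : f a < f b := by
    by_contra! hle
    have hlt : f b < f a := hle.lt_of_ne fun h => hab.ne' (hinj hb ha h)
    rw [nhdsWithin_Ioo_eq_nhdsGT two_pos] at hlim
    obtain ⟨e, hfe, he0, hea⟩ :=
      ((hlim.eventually_lt_const hfb).and (Ioo_mem_nhdsGT ha.1)).exists
    obtain ⟨c, hc, hfc⟩ := exists_mem_Icc_eq_of_no_upward_jumps hea.le
      (fun x hx => hleft ⟨he0.trans hx.1, hx.2.trans_lt ha.2⟩)
      (fun x hx => hright ⟨he0.trans_le hx.1, hx.2.trans ha.2⟩) hfe hlt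
    exact (hc.2.trans_lt hab).ne
      (hinj ⟨he0.trans_le hc.1, hc.2.trans_lt ha.2⟩ hb hfc)
  intro a ha b hb hab
  rcases (hnonneg b hb).eq_or_lt with hfb | hfb
  · have hfa : f b < f a := (hfb ▸ hnonneg a ha).lt_of_ne fun h => hab.ne' (hinj hb ha h)
    obtain ⟨y, hya, hby, hy2⟩ :=
      ((hright hb hfa).and (Ioo_mem_nhdsGT hb.2)).exists
    have hy : y ∈ Set.Ioo (0 : ℝ) 2 := ⟨hb.1.trans hby, hy2⟩
    have hfy : 0 < f y := (hnonneg y hy).lt_of_ne fun h => hby.ne (hinj hb hy (hfb ▸ h))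
    exact absurd (hpos ha hy (hab.trans hby) hfy) hya.not_gt
  · exact hpos ha hb hab hfb
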